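/- For a positive integer n, g ∈ {0,1}, and r ≥ 2, define A_{n,g}(z) = Σ_{m=0}^{n} binomial(n−g+1/r, m)·binomial(2n−g−m, n−g)·(−z)^m and C_{n,g}(z) = Σ_{m=0}^{n} binomial(n−1/r, n−m)·binomial(n−g+1/r, m)·z^m. Then C_{n,g}(z) = A_{n,g}(1 − z) as polynomials. -/

import Mathlib

noncomputable def gbinom (x : ℝ) (k : ℕ) : ℝ :=
  (∏ i ∈ Finset.range k, (x - i)) / (Nat.factorial k)

/-- The Padé approximation polynomial `A_{n,g}` to `(1-z)^{1/r}`. -/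
noncomputable def padeA (r : ℝ) (n g : ℕ) (z : ℂ) : ℂ :=
  ∑ m ∈ Finset.range (n + 1),
    (gbinom ((n : ℝ) - g + 1 / r) m : ℂ) * (Nat.choose (2 * n - g - m) (n - g) : ℂ) * (-z) ^ m

/-- The Padé approximation polynomial `B_{n,g}` to `(1-z)^{1/r}`. -/
noncomputable def padeB (r : ℝ) (n g : ℕ) (z : ℂ) : ℂ :=
  ∑ m ∈ Finset.range (n - g + 1),
    (gbinom ((n : ℝ) - 1 / r) m : ℂ) * (Nat.choose (2 * n - g - m) n : ℂ) * (-z) ^ m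

theorem gbinom_eq_choose (x : ℝ) (k : ℕ) : gbinom x k = Ring.choose x k := by
  rw [gbinom, ← descPochhammer_eval_eq_prod_range, Ring.choose_eq_smul,
    smul_eq_mul, div_eq_inv_mul, ← descPochhammer_map (Int.castRingHom ℝ) k, Polynomial.eval_map,
    ← Polynomial.eval₂_smulOneHom_eq_smeval ℤ, Subsingleton.elim RingHom.smulOneHom]

theorem ofReal_gbinom (x : ℝ) (k : ℕ) : (gbinom x k : ℂ) = Ring.choose (x : ℂ) k := by
  rw [gbinom_eq_choose]
  exact Ring.map_choose Complex.ofRealHom x k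

/-- Re-expansion in powers of `w` of the Jacobi-type sum
`∑ k, choose y (n - k) * choose x k * (w + 1) ^ k`. -/
theorem sum_choose_mul_choose_mul_add_one_pow {R : Type*} [CommRing R] [BinomialRing R]
    (x y w : R) (n : ℕ) :
    ∑ k ∈ Finset.range (n + 1), Ring.choose y (n - k) * Ring.choose x k * (w + 1) ^ k =
      ∑ j ∈ Finset.range (n + 1),
        Ring.choose x j * Ring.choose (x + y - j) (n - j) * w ^ j := by
  simp_rw [add_pow w 1, Finset.mul_sum]
  rw [Finset.sum_comm' (s' := fun j => Finset.Ico j (n + 1)) (t' := Finset.range (n + 1))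
    (by intro k j; simp only [Finset.mem_range, Finset.mem_Ico]; omega)]
  refine Finset.sum_congr rfl fun j hj => ?_
  have hjn : j ≤ n := Nat.lt_succ_iff.mp (Finset.mem_range.mp hj)
  rw [show x + y - j = (x - j) + y by ring, Ring.add_choose_eq _ (Commute.all _ _),
    Finset.Nat.sum_antidiagonal_eq_sum_range_succ_mk, Finset.sum_Ico_eq_sum_range,
    Finset.mul_sum, Finset.sum_mul, Nat.succ_eq_add_one, Nat.sub_add_comm hjn]
  refine Finset.sum_congr rfl fun i _ => ?_
  have h := Ring.choose_smul_choose x (Nat.le_add_right j i)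
  rw [nsmul_eq_mul, Nat.add_sub_cancel_left] at h
  rw [one_pow, mul_one, ← Nat.sub_sub]
  linear_combination (Ring.choose y (n - j - i) * w ^ j) * h

theorem stmt_8 (r n g : ℕ) (hr : 2 ≤ r) (hn : 1 ≤ n) (hg : g ≤ 1) (z : ℂ) :
    ∑ m ∈ Finset.range (n + 1),
        (gbinom ((n : ℝ) - 1 / r) (n - m) : ℂ) * (gbinom ((n : ℝ) - g + 1 / r) m : ℂ) * z ^ m
      = padeA r n g (1 - z) := by
  have hz : z = -(1 - z) + 1 := by ring
  rw [padeA]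
  simp_rw [ofReal_gbinom]
  conv_lhs => rw [hz]
  rw [sum_choose_mul_choose_mul_add_one_pow]
  refine Finset.sum_congr rfl fun j hj => ?_
  have hjn : j ≤ n := Nat.lt_succ_iff.mp (Finset.mem_range.mp hj)
  have hsum : (((n : ℝ) - g + 1 / r : ℝ) : ℂ) + (((n : ℝ) - 1 / r : ℝ) : ℂ) - j =
      ((2 * n - g - j : ℕ) : ℂ) := by
    rw [Nat.cast_sub (by omega), Nat.cast_sub (by omega)]
    push_cast
    ring
  rw [hsum, Ring.choose_natCast,
    Nat.choose_symm_of_eq_add (show 2 * n - g - j = (n - j) + (n - g) by omega)]
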